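/- Consider a (possibly non-developable) bird's-foot degree-4 rigid origami vertex: sector angles with α₁ = α₂ ∈ (0, π) and α₃ = α₄ ∈ (0, π). If (ρ₁, ρ₂, ρ₃, ρ₄) satisfies the rotation-matrix closure condition with ρ₁, ρ₂ ∈ (−π, π) and ρ₁ ≠ 0, then tan(ρ₂/2) = (sin α₁ · cot α₃ + cos α₁ · cos ρ₁) / sin ρ₁. -/

import Mathlib

open Real Matrix

/-- Rotation of ℝ³ by angle `β` about the x-axis. -/
noncomputable def Rx (β : ℝ) : Matrix (Fin 3) (Fin 3) ℝ :=
  !![1, 0, 0;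
     0, Real.cos β, -Real.sin β;
     0, Real.sin β, Real.cos β]

/-- Rotation of ℝ³ by angle `β` about the z-axis. -/
noncomputable def Rz (β : ℝ) : Matrix (Fin 3) (Fin 3) ℝ :=
  !![Real.cos β, -Real.sin β, 0;
     Real.sin β, Real.cos β, 0;
     0, 0, 1]

/-- The spherical-linkage loop (closure) condition for a degree-4 origami vertex with
sector angles `α₁, α₂, α₃, α₄` and folding angles `ρ₁, ρ₂, ρ₃, ρ₄`. -/
def ClosureCond (α₁ α₂ α₃ α₄ ρ₁ ρ₂ ρ₃ ρ₄ : ℝ) : Prop :=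
  Rx ρ₁ * Rz α₁ * Rx ρ₂ * Rz α₂ * Rx ρ₃ * Rz α₃ * Rx ρ₄ * Rz α₄ = 1

/-- Closure condition, `Fin 4`-indexed version (index `j` ↔ paper index `j+1`). -/
def ClosureCondF (α ρ : Fin 4 → ℝ) : Prop :=
  ClosureCond (α 0) (α 1) (α 2) (α 3) (ρ 0) (ρ 1) (ρ 2) (ρ 3)
theorem Rx_inv (x : ℝ) : Rx (-x) * Rx x = 1 := by
  ext i j
  have := Real.sin_sq_add_cos_sq x
  fin_cases i <;> fin_cases j <;>
    simp [Rx, Matrix.mul_apply, Fin.sum_univ_three] <;> nlinarith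

theorem Rz_inv (x : ℝ) : Rz (-x) * Rz x = 1 := by
  ext i j
  have := Real.sin_sq_add_cos_sq x
  fin_cases i <;> fin_cases j <;>
    simp [Rz, Matrix.mul_apply, Fin.sum_univ_three] <;> nlinarith

/-- Eq. (9) of Example 2: `ρ₂` as a function of `ρ₁` for a (possibly non-developable)
bird's-foot degree-4 vertex. -/
theorem birds_foot_rho2 (α₁ α₂ α₃ α₄ ρ₁ ρ₂ ρ₃ ρ₄ : ℝ)
    (hα₁ : α₁ ∈ Set.Ioo 0 π) (hα₃ : α₃ ∈ Set.Ioo 0 π)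
    (h12 : α₁ = α₂) (h34 : α₃ = α₄)
    (hρ₁ : ρ₁ ∈ Set.Ioo (-π) π) (hρ₂ : ρ₂ ∈ Set.Ioo (-π) π) (hρ₁0 : ρ₁ ≠ 0)
    (hclose : ClosureCond α₁ α₂ α₃ α₄ ρ₁ ρ₂ ρ₃ ρ₄) :
    Real.tan (ρ₂ / 2)
      = (Real.sin α₁ * Real.cot α₃ + Real.cos α₁ * Real.cos ρ₁) / Real.sin ρ₁ := by
  subst h12 h34
  have hM : Rx ρ₂ * (Rz α₁ * (Rx ρ₃ * (Rz α₃ * Rx ρ₄))) =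
      Rz (-α₁) * (Rx (-ρ₁) * Rz (-α₃)) := by
    have hz : Rz α₃ * Rz (-α₃) = 1 := mul_eq_one_comm.mp (Rz_inv α₃)
    unfold ClosureCond at hclose
    have h1 : Rz (-α₁) * (Rx (-ρ₁) * ((Rx ρ₁ * Rz α₁ * Rx ρ₂ * Rz α₁ * Rx ρ₃ * Rz α₃ * Rx ρ₄ *
        Rz α₃) * Rz (-α₃))) = Rz (-α₁) * (Rx (-ρ₁) * Rz (-α₃)) := by
      rw [hclose, one_mul]
    rw [← h1]
    simp only [mul_assoc]
    rw [hz, mul_one, ← mul_assoc (Rx (-ρ₁)) (Rx ρ₁), Rx_inv, one_mul,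
      ← mul_assoc (Rz (-α₁)) (Rz α₁), Rz_inv, one_mul]
  have e0 := congrFun (congrFun hM 0) 0
  have e1 := congrFun (congrFun hM 1) 0
  have e2 := congrFun (congrFun hM 2) 0
  simp [Rx, Rz, Matrix.mul_apply, Fin.sum_univ_three] at e0 e1 e2
  have hsa : 0 < sin α₁ := Real.sin_pos_of_mem_Ioo hα₁
  have hsb : 0 < sin α₃ := Real.sin_pos_of_mem_Ioo hα₃
  have hc : 0 < cos (ρ₂ / 2) :=
    Real.cos_pos_of_mem_Ioo ⟨by linarith [hρ₂.1], by linarith [hρ₂.2]⟩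
  have hs1 : sin ρ₁ ≠ 0 := by
    intro h
    exact hρ₁0 ((Real.sin_eq_zero_iff_of_lt_of_lt hρ₁.1 hρ₁.2).mp h)
  have h2s : sin ρ₂ = 2 * sin (ρ₂ / 2) * cos (ρ₂ / 2) := by
    rw [← Real.sin_two_mul]; congr 1; ring
  have h2c : cos ρ₂ = 2 * cos (ρ₂ / 2) ^ 2 - 1 := by
    rw [← Real.cos_two_mul]; congr 1; ring
  have hp := Real.sin_sq_add_cos_sq (ρ₂ / 2)
  rw [h2s, h2c] at e1 e2
  rw [Real.tan_eq_sin_div_cos, Real.cot_eq_cos_div_sin]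
  generalize sin (ρ₂ / 2) = s at *
  generalize cos (ρ₂ / 2) = c at *
  have h31 : cos ρ₃ = cos ρ₁ := by
    rcases e0 with (h | h) | h
    · exact h
    · exact absurd h hsb.ne'
    · exact absurd h hsa.ne'
  rw [h31] at e1 e2
  have f1 : c * (sin α₁ * cos α₃ + cos α₁ * (cos ρ₁ * sin α₃)) = s * (sin α₃ * sin ρ₃) := by
    apply mul_left_cancel₀ (mul_pos two_pos hc).ne'
    linarith
  have f2 : sin α₃ * sin ρ₃ = sin α₃ * sin ρ₁ := by
    linear_combination e2 - 2 * s * f1 + (- 2 * sin α₃ * sin ρ₃) * hp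
  rw [f2] at f1
  field_simp
  linarith
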